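/- arXiv:2411.18213 — 6 statements merged into one kernel-verified Lean document; each statement's English description precedes it below -/
import Mathlib

section
/- Let a > 0 and b, D₁ ∈ ℝ. The function Z(r) = b/a + D₁·I₀(√a·r) is twice differentiable on (0,∞) and satisfies the ordinary differential equation Z''(r) + Z'(r)/r − a·Z(r) + b = 0 for every r > 0. -/
open Real Filter Set

/-- Modified Bessel function of the first kind of order zero:
`I₀(x) = ∑ x^(2n) / (4^n (n!)²)`. -/
noncomputable def I0 (x : ℝ) : ℝ :=
  ∑' n : ℕ, x ^ (2 * n) / ((4 : ℝ) ^ n * ((n.factorial : ℝ)) ^ 2)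

/-- Modified Bessel function of the first kind of order one:
`I₁(x) = ∑ x^(2n+1) / (2^(2n+1) n! (n+1)!)`. -/
noncomputable def I1 (x : ℝ) : ℝ :=
  ∑' n : ℕ, x ^ (2 * n + 1) /
    ((2 : ℝ) ^ (2 * n + 1) * (n.factorial : ℝ) * (((n + 1).factorial : ℝ)))

/-- Termwise differentiation of a series on the real line whose terms vanish at `0` and whose
termwise derivatives are dominated by the terms of `|x| * exp (x ^ 2)`. -/
lemma hasDerivAt_tsum_of_abs_le {f g : ℕ → ℝ → ℝ} (hf : ∀ n x, HasDerivAt (f n) (g n x) x)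
    (hg : ∀ n x, |g n x| ≤ |x| * ((x ^ 2) ^ n / (n.factorial : ℝ))) (h0 : ∀ n, f n 0 = 0)
    (x : ℝ) : HasDerivAt (fun y => ∑' n, f n y) (∑' n, g n x) x := by
  have hR : (0 : ℝ) < |x| + 1 := by positivity
  refine hasDerivAt_tsum_of_isPreconnected
    (u := fun n : ℕ => (|x| + 1) * (((|x| + 1) ^ 2) ^ n / (n.factorial : ℝ)))
    (t := Metric.ball 0 (|x| + 1)) (y₀ := 0)
    ((Real.summable_pow_div_factorial _).mul_left _) Metric.isOpen_ball
    (convex_ball _ _).isPreconnected (fun n y _ => hf n y) (fun n y hy => ?_)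
    (Metric.mem_ball_self hR) ?_ ?_
  · have hy' : |y| ≤ |x| + 1 := by simpa using (mem_ball_zero_iff.mp hy).le
    refine (hg n y).trans ?_
    rw [← sq_abs y]
    gcongr
  · simp [h0]
  · simp

lemma I0_eq_one_add_tsum (x : ℝ) :
    I0 x = 1 + ∑' n : ℕ,
      x ^ (2 * (n + 1)) / ((4 : ℝ) ^ (n + 1) * (((n + 1).factorial : ℝ)) ^ 2) := by
  have hs : Summable fun n : ℕ => x ^ (2 * n) / ((4 : ℝ) ^ n * ((n.factorial : ℝ)) ^ 2) := by
    refine (Real.summable_pow_div_factorial (x ^ 2)).of_nonneg_of_le (fun n => ?_) fun n => ?_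
    · rw [pow_mul]; positivity
    · rw [pow_mul]
      have h1 : (1 : ℝ) ≤ n.factorial := by exact_mod_cast n.factorial_pos
      have h4 : (1 : ℝ) ≤ 4 ^ n := one_le_pow₀ (by norm_num)
      gcongr
      nlinarith [mul_le_mul h4 h1 zero_le_one (by positivity)]
  rw [I0, hs.tsum_eq_zero_add]
  simp

lemma hasDerivAt_I0 (x : ℝ) : HasDerivAt I0 (I1 x) x := by
  have key := hasDerivAt_tsum_of_abs_le
    (f := fun n x => x ^ (2 * (n + 1)) / ((4 : ℝ) ^ (n + 1) * (((n + 1).factorial : ℝ)) ^ 2))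
    (g := fun n x => x ^ (2 * n + 1) /
      ((2 : ℝ) ^ (2 * n + 1) * (n.factorial : ℝ) * (((n + 1).factorial : ℝ))))
    (fun n x => ?_) (fun n x => ?_) (fun n => by simp) x
  · rw [funext I0_eq_one_add_tsum]
    exact key.const_add 1
  · refine ((hasDerivAt_pow (2 * (n + 1)) x).div_const _).congr_deriv ?_
    have h2 : (2 : ℝ) ^ (2 * n + 1) = 2 * 4 ^ n := by rw [pow_succ, pow_mul]; norm_num; ring
    have hn : 2 * (n + 1) - 1 = 2 * n + 1 := by omega
    rw [h2, hn, Nat.factorial_succ]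
    have := n.factorial_ne_zero
    push_cast
    field_simp
    ring
  · have h1 : (1 : ℝ) ≤ (n + 1).factorial := by exact_mod_cast (n + 1).factorial_pos
    have h2 : (1 : ℝ) ≤ 2 ^ (2 * n + 1) := one_le_pow₀ (by norm_num)
    rw [abs_div, abs_pow, abs_of_pos (by positivity : (0 : ℝ) < 2 ^ (2 * n + 1) *
      n.factorial * (n + 1).factorial), pow_succ, pow_mul, sq_abs, mul_comm, mul_div_assoc]
    gcongr
    have h3 : (n.factorial : ℝ) ≤ 2 ^ (2 * n + 1) * n.factorial :=
      le_mul_of_one_le_left (by positivity) h2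
    exact h3.trans (le_mul_of_one_le_right (by positivity) h1)

lemma hasDerivAt_id_mul_I1 (x : ℝ) : HasDerivAt (fun y => y * I1 y) (x * I0 x) x := by
  have key := hasDerivAt_tsum_of_abs_le
    (f := fun n x => x * (x ^ (2 * n + 1) /
      ((2 : ℝ) ^ (2 * n + 1) * (n.factorial : ℝ) * (((n + 1).factorial : ℝ)))))
    (g := fun n x => x * (x ^ (2 * n) / ((4 : ℝ) ^ n * ((n.factorial : ℝ)) ^ 2)))
    (fun n x => ?_) (fun n x => ?_) (fun n => by simp) x
  · simpa only [tsum_mul_left, I0, I1] using key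
  · refine ((hasDerivAt_id x).mul ((hasDerivAt_pow (2 * n + 1) x).div_const _)).congr_deriv ?_
    have h2 : (2 : ℝ) ^ (2 * n + 1) = 2 * 4 ^ n := by rw [pow_succ, pow_mul]; norm_num; ring
    rw [h2, Nat.factorial_succ]
    have := n.factorial_ne_zero
    simp only [id, Nat.add_sub_cancel]
    push_cast
    field_simp
    ring
  · have h1 : (1 : ℝ) ≤ n.factorial := by exact_mod_cast n.factorial_pos
    have h4 : (1 : ℝ) ≤ 4 ^ n := one_le_pow₀ (by norm_num)
    rw [abs_mul, pow_mul, abs_of_nonneg (by positivity : (0 : ℝ) ≤ (x ^ 2) ^ n /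
      (4 ^ n * (n.factorial : ℝ) ^ 2))]
    gcongr
    nlinarith [mul_le_mul h4 h1 zero_le_one (by positivity)]

lemma hasDerivAt_I1 {x : ℝ} (hx : x ≠ 0) : HasDerivAt I1 (I0 x - I1 x / x) x := by
  have h := (hasDerivAt_id_mul_I1 x).div (hasDerivAt_id x) hx
  have h' : HasDerivAt (fun y => y * I1 y / y) (I0 x - I1 x / x) x := by
    refine h.congr_deriv ?_
    simp only [id]
    field_simp
  refine h'.congr_of_eventuallyEq ?_
  filter_upwards [eventually_ne_nhds hx] with y hy
  field_simp

/-- for `a > 0`, the function `Z(r) = b/a + D₁·I₀(√a·r)` is twice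
differentiable on `(0,∞)` and satisfies `Z'' + Z'/r − a·Z + b = 0` there. -/
theorem Z_solves_ODE (a b D₁ : ℝ) (ha : 0 < a) :
    let Z : ℝ → ℝ := fun r => b / a + D₁ * I0 (Real.sqrt a * r)
    ∀ r : ℝ, 0 < r →
      DifferentiableAt ℝ Z r ∧ DifferentiableAt ℝ (deriv Z) r ∧
      deriv (deriv Z) r + deriv Z r / r - a * Z r + b = 0 := by
  intro Z r hr
  have hs : 0 < √a := Real.sqrt_pos.mpr ha
  have hlin (t : ℝ) : HasDerivAt (fun r => √a * r) (√a) t := by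
    simpa using (hasDerivAt_id t).const_mul (√a)
  have hZ (t : ℝ) : HasDerivAt Z (D₁ * (I1 (√a * t) * √a)) t :=
    (((hasDerivAt_I0 (√a * t)).comp t (hlin t)).const_mul D₁).const_add (b / a)
  have hdZ : deriv Z = fun t => D₁ * (I1 (√a * t) * √a) := funext fun t => (hZ t).deriv
  have hZ' : HasDerivAt (deriv Z)
      (D₁ * ((I0 (√a * r) - I1 (√a * r) / (√a * r)) * √a * √a)) r := by
    rw [hdZ]
    exact (((hasDerivAt_I1 (mul_pos hs hr).ne').comp r (hlin r)).mul_const _).const_mul D₁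
  refine ⟨(hZ r).differentiableAt, hZ'.differentiableAt, ?_⟩
  rw [hZ'.deriv, hdZ, mul_assoc _ √a √a, Real.mul_self_sqrt ha.le]
  simp only [Z]
  field_simp
  rw [Real.sq_sqrt ha.le]
  ring
end

section
/- Let μ_e, μ_m, μ_M, L_c > 0 and μ_c ≥ 0 be real constants, and let p, q : (0,∞) → ℝ be twice differentiable functions satisfying for every r > 0: (i) μ_e·(p'(r) + q'(r) + 2(p(r)+q(r))/r) = μ_c·(p'(r) − q'(r)); (ii) (μ_e + μ_m)·(p(r)+q(r)) + μ_c·(p(r)−q(r)) + μ_M·L_c²·(q'(r)/r + (p(r)+q(r))/r²) = 0; (iii) (μ_e + μ_m)·(p(r)+q(r)) + μ_c·(q(r)−p(r)) + μ_M·L_c²·(−q''(r) + (p(r)+q(r))/r² − p'(r)/r − q'(r)/r) = 0. If the function p + q is bounded on (0,1) and p(R) = 0 for some R > 0, then p and q are identically zero on (0,∞). -/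
open Real Filter Set

/-- A function with zero derivative at every positive real takes one value there. -/
theorem eq_of_hasDerivAt_zero_of_pos {f : ℝ → ℝ}
    (hf : ∀ r : ℝ, 0 < r → HasDerivAt f 0 r) {x y : ℝ} (hx : 0 < x) (hy : 0 < y) :
    f x = f y :=
  isOpen_Ioi.is_const_of_deriv_eq_zero isPreconnected_Ioi
    (fun r hr => (hf r hr).differentiableAt.differentiableWithinAt)
    (fun r hr => (hf r hr).deriv) hx hy

/-- The only solution of `r s' + 2 s = 0` on the positive reals that stays bounded near the
origin is zero. -/
theorem eq_zero_of_euler_of_bounded {s s' : ℝ → ℝ}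
    (hs : ∀ r : ℝ, 0 < r → HasDerivAt s (s' r) r)
    (hode : ∀ r : ℝ, 0 < r → r * s' r + 2 * s r = 0)
    (hbdd : ∃ M : ℝ, ∀ r ∈ Set.Ioo (0 : ℝ) 1, |s r| ≤ M) {x : ℝ} (hx : 0 < x) :
    s x = 0 := by
  obtain ⟨M, hM⟩ := hbdd
  have hconst : ∀ r : ℝ, 0 < r → r ^ 2 * s r = x ^ 2 * s x := fun r hr =>
    eq_of_hasDerivAt_zero_of_pos (f := fun t => t ^ 2 * s t) (fun t ht => by
      refine ((hasDerivAt_pow 2 t).mul (hs t ht)).congr_deriv ?_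
      push_cast
      linear_combination t * hode t ht) hr hx
  have hlim : Tendsto (fun r : ℝ => r ^ 2 * M) (nhdsWithin 0 (Set.Ioi 0)) (nhds 0) := by
    have hcont : Continuous fun r : ℝ => r ^ 2 * M := by fun_prop
    simpa using (hcont.tendsto 0).mono_left nhdsWithin_le_nhds
  have hle : |x ^ 2 * s x| ≤ 0 := by
    refine ge_of_tendsto hlim ?_
    filter_upwards [Ioo_mem_nhdsGT (zero_lt_one' ℝ)] with r hr
    rw [← hconst r hr.1, abs_mul, abs_of_nonneg (sq_nonneg r)]
    exact mul_le_mul_of_nonneg_left (hM r hr) (sq_nonneg r)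
  have hzero : x ^ 2 * s x = 0 := abs_nonpos_iff.mp hle
  exact (mul_eq_zero.mp hzero).resolve_left (pow_pos hx 2).ne'

/-- the off-diagonal microdistortion components of the axisymmetric
relaxed micromorphic extension problem vanish identically. -/
theorem offdiagonal_microdistortion_vanishes
    (μe μm μM Lc μc : ℝ) (hμe : 0 < μe) (hμm : 0 < μm) (hμM : 0 < μM) (hLc : 0 < Lc)
    (hμc : 0 ≤ μc) (p q : ℝ → ℝ)
    (hp : ∀ r : ℝ, 0 < r → DifferentiableAt ℝ p r)
    (hp' : ∀ r : ℝ, 0 < r → DifferentiableAt ℝ (deriv p) r)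
    (hq : ∀ r : ℝ, 0 < r → DifferentiableAt ℝ q r)
    (hq' : ∀ r : ℝ, 0 < r → DifferentiableAt ℝ (deriv q) r)
    (heq1 : ∀ r : ℝ, 0 < r →
      μe * (deriv p r + deriv q r + 2 * (p r + q r) / r) = μc * (deriv p r - deriv q r))
    (heq2 : ∀ r : ℝ, 0 < r →
      (μe + μm) * (p r + q r) + μc * (p r - q r) +
        μM * Lc ^ 2 * (deriv q r / r + (p r + q r) / r ^ 2) = 0)
    (heq3 : ∀ r : ℝ, 0 < r →
      (μe + μm) * (p r + q r) + μc * (q r - p r) +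
        μM * Lc ^ 2 *
          (-(deriv (deriv q) r) + (p r + q r) / r ^ 2 - deriv p r / r - deriv q r / r) = 0)
    (hbdd : ∃ M : ℝ, ∀ r ∈ Set.Ioo (0 : ℝ) 1, |p r + q r| ≤ M)
    (R : ℝ) (hR : 0 < R) (hpR : p R = 0) :
    ∀ r : ℝ, 0 < r → p r = 0 ∧ q r = 0 := by
  have hs : ∀ r : ℝ, 0 < r → HasDerivAt (fun t => p t + q t) (deriv p r + deriv q r) r :=
    fun r hr => (hp r hr).hasDerivAt.add (hq r hr).hasDerivAt
  -- Differentiating `r` times the second equation and adding the third cancels every `Lc` term.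
  have hode : ∀ r : ℝ, 0 < r → r * (deriv p r + deriv q r) + 2 * (p r + q r) = 0 := by
    intro r hr
    have hr0 : r ≠ 0 := hr.ne'
    have hd := ((hp r hr).hasDerivAt.sub (hq r hr).hasDerivAt)
    have hF := ((((hasDerivAt_id r).mul (hs r hr)).const_mul (μe + μm)).add
      (((hasDerivAt_id r).mul hd).const_mul μc)).add
      (((hq' r hr).hasDerivAt.add ((hs r hr).div (hasDerivAt_id r) hr0)).const_mul
        (μM * Lc ^ 2))
    have hF0 := hF.unique ((hasDerivAt_const r (0 : ℝ)).congr_of_eventuallyEq (by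
      filter_upwards [Ioi_mem_nhds hr] with t ht
      have ht0 : t ≠ 0 := (Set.mem_Ioi.mp ht).ne'
      have h2 := heq2 t ht
      simp only [Pi.add_apply, Pi.mul_apply, Pi.sub_apply, Pi.div_apply, id]
      field_simp at h2 ⊢
      linear_combination h2))
    have h1 := heq1 r hr
    have h3 := heq3 r hr
    simp only [id, Pi.sub_apply] at hF0
    have hsum : (2 * μe + μm) * (r * (deriv p r + deriv q r) + 2 * (p r + q r)) = 0 := by
      field_simp at h1 h3 hF0 ⊢
      have hr2 : r ^ 2 ≠ 0 := pow_ne_zero 2 hr0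
      refine mul_left_cancel₀ hr2 ?_
      linear_combination hF0 + h3 + r ^ 2 * h1
    exact (mul_eq_zero.mp hsum).resolve_left (by positivity)
  have hs0 : ∀ r : ℝ, 0 < r → p r + q r = 0 := fun r hr =>
    eq_zero_of_euler_of_bounded hs hode hbdd hr
  have hp0 : ∀ r : ℝ, 0 < r → deriv p r = 0 := by
    intro r hr
    have hr0 : r ≠ 0 := hr.ne'
    have hsr := hs0 r hr
    have hd : deriv p r + deriv q r = 0 := by
      have h := hode r hr
      rw [hsr, mul_zero, add_zero] at h
      exact (mul_eq_zero.mp h).resolve_left hr0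
    have hq_eq : deriv q r = -deriv p r := by linarith
    have h1 : μc * deriv p r = 0 := by
      have h := heq1 r hr
      rw [hsr, hd, hq_eq] at h
      simp only [mul_zero, zero_div, add_zero] at h
      linarith
    have h2 := heq2 r hr
    rw [hsr, hq_eq] at h2
    field_simp at h2
    have hsq : μM * Lc ^ 2 * r * (deriv p r * deriv p r) = 0 := by
      linear_combination (-deriv p r) * h2 + r ^ 2 * (p r - q r) * h1
    exact mul_self_eq_zero.mp ((mul_eq_zero.mp hsq).resolve_left (by positivity))
  intro r hr
  have hpr : p r = 0 := by
    rw [← hpR]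
    exact eq_of_hasDerivAt_zero_of_pos
      (fun t ht => (hp0 t ht) ▸ (hp t ht).hasDerivAt) hr hR
  exact ⟨hpr, by linarith [hs0 r hr]⟩
end

section
/- Let λ_e, μ_e, λ_m, μ_m ∈ ℝ with μ_m ≠ 0 and μ_e + κ_e ≠ 0, where κ_e = λ_e + μ_e, and set B = (μ_m·λ_e − μ_e·λ_m)/(μ_m·(μ_e + κ_e)). Suppose u, P_rr, P_θθ are real functions on an open interval I ⊆ (0,∞), with u twice differentiable and P_rr, P_θθ differentiable, satisfying for every r ∈ I: (i) (2μ_e + λ_e)·d/dr(u'(r) + u(r)/r) − 2μ_e·(P_rr'(r) − (P_θθ(r) − P_rr(r))/r) − λ_e·(P_θθ + P_rr)'(r) = 0; (ii) 2μ_m·(P_rr'(r) + (P_rr(r) − P_θθ(r))/r) + λ_m·(P_θθ + P_rr)'(r) = 0. Then the function r ↦ u'(r) + u(r)/r − B·(P_θθ(r) + P_rr(r)) has derivative zero on I; in particular, if I is an interval it is constant, i.e. there exists C₁ ∈ ℝ with u'(r) + u(r)/r = B·(P_θθ(r) + P_rr(r)) + C₁ for all r ∈ I. -/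
open Real Filter Set

/-- first integral of the axisymmetric system:
`u' + u/r − B·(P_θθ + P_rr)` has zero derivative on the open interval `I`,
hence is constant there. -/
theorem first_integral (lo hi : ℝ) (hI : Set.Ioo lo hi ⊆ Set.Ioi (0 : ℝ))
    (lam_e μe lam_m μm : ℝ) (hμm : μm ≠ 0) (hκe : μe + (lam_e + μe) ≠ 0)
    (B : ℝ) (hB : B = (μm * lam_e - μe * lam_m) / (μm * (μe + (lam_e + μe))))
    (u Prr Pθθ : ℝ → ℝ)
    (hu : ∀ r ∈ Set.Ioo lo hi, DifferentiableAt ℝ u r)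
    (hu' : ∀ r ∈ Set.Ioo lo hi, DifferentiableAt ℝ (deriv u) r)
    (hPrr : ∀ r ∈ Set.Ioo lo hi, DifferentiableAt ℝ Prr r)
    (hPθθ : ∀ r ∈ Set.Ioo lo hi, DifferentiableAt ℝ Pθθ r)
    (heq1 : ∀ r ∈ Set.Ioo lo hi,
      (2 * μe + lam_e) * deriv (fun s => deriv u s + u s / s) r -
        2 * μe * (deriv Prr r - (Pθθ r - Prr r) / r) -
        lam_e * deriv (fun s => Pθθ s + Prr s) r = 0)
    (heq2 : ∀ r ∈ Set.Ioo lo hi,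
      2 * μm * (deriv Prr r + (Prr r - Pθθ r) / r) +
        lam_m * deriv (fun s => Pθθ s + Prr s) r = 0) :
    (∀ r ∈ Set.Ioo lo hi,
      HasDerivAt (fun s => deriv u s + u s / s - B * (Pθθ s + Prr s)) 0 r) ∧
    (∃ C₁ : ℝ, ∀ r ∈ Set.Ioo lo hi,
      deriv u r + u r / r = B * (Pθθ r + Prr r) + C₁) := by
  have hderiv : ∀ r ∈ Set.Ioo lo hi,
      HasDerivAt (fun s => deriv u s + u s / s - B * (Pθθ s + Prr s)) 0 r := by
    intro r hr
    have hr0 : r ≠ 0 := ne_of_gt (hI hr)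
    have hD : DifferentiableAt ℝ (fun s => deriv u s + u s / s) r :=
      (hu' r hr).add ((hu r hr).div differentiableAt_id hr0)
    have hS : DifferentiableAt ℝ (fun s => Pθθ s + Prr s) r := (hPθθ r hr).add (hPrr r hr)
    have h1 := heq1 r hr
    have h2 := heq2 r hr
    have key : deriv (fun s => deriv u s + u s / s) r
        - B * deriv (fun s => Pθθ s + Prr s) r = 0 := by
      generalize deriv (fun s => deriv u s + u s / s) r = D at h1 ⊢
      generalize deriv (fun s => Pθθ s + Prr s) r = S at h1 h2 ⊢
      have hBmul : B * (μm * (μe + (lam_e + μe))) = μm * lam_e - μe * lam_m := by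
        rw [hB, div_mul_cancel₀ _ (mul_ne_zero hμm hκe)]
      refine (mul_eq_zero.mp ?_).resolve_left (mul_ne_zero hμm hκe)
      linear_combination μm * h1 + μe * h2 - S * hBmul
    exact key ▸ hD.hasDerivAt.sub (hS.hasDerivAt.const_mul B)
  refine ⟨hderiv, ?_⟩
  obtain ⟨C₁, hC₁⟩ := isOpen_Ioo.exists_is_const_of_deriv_eq_zero isPreconnected_Ioo
    (fun r hr => (hderiv r hr).differentiableAt.differentiableWithinAt)
    (fun r hr => (hderiv r hr).deriv)
  exact ⟨C₁, fun r hr => by linear_combination hC₁ r hr⟩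
end

section
/- Let λ_e, μ_e, λ_m, μ_m, μ_M, L_c ∈ ℝ and suppose u, P_rr, P_θθ are twice continuously differentiable real functions on an open interval I ⊆ (0,∞) satisfying for every r ∈ I the three axisymmetric equilibrium equations: (i) (2μ_e + λ_e)·d/dr(u'(r) − P_rr(r)) + λ_e·d/dr(u(r)/r − P_θθ(r)) = −2μ_e·d/dr(u(r)/r − P_θθ(r)) − 2μ_e·(P_θθ'(r) + (P_θθ(r) − P_rr(r))/r); (ii) (2μ_e + λ_e)·(u'(r) − P_rr(r)) + λ_e·(u(r)/r − P_θθ(r)) = 2μ_m·P_rr(r) + λ_m·(P_rr(r) + P_θθ(r)) − (μ_M·L_c²/r)·(P_θθ'(r) + (P_θθ(r) − P_rr(r))/r); (iii) (2μ_e + λ_e)·(u(r)/r − P_θθ(r)) + λ_e·(u'(r) − P_rr(r)) = 2μ_m·P_θθ(r) + λ_m·(P_rr(r) + P_θθ(r)) − μ_M·L_c²·d/dr(P_θθ'(r) + (P_θθ(r) − P_rr(r))/r). Then for every r ∈ I: 2μ_m·(P_rr'(r) + (P_rr(r) − P_θθ(r))/r) + λ_m·(P_rr + P_θθ)'(r)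 = 0. -/
open Real Filter Set

theorem ContDiffOn.differentiableAt_and_deriv {f : ℝ → ℝ} {s : Set ℝ} (hf : ContDiffOn ℝ 2 f s)
    (hs : IsOpen s) {x : ℝ} (hx : x ∈ s) :
    DifferentiableAt ℝ f x ∧ DifferentiableAt ℝ (deriv f) x :=
  ⟨(hf.differentiableOn (by norm_num)).differentiableAt (hs.mem_nhds hx),
    ((hf.deriv_of_isOpen hs (m := 1) (by norm_num)).differentiableOn
      (by norm_num)).differentiableAt (hs.mem_nhds hx)⟩

/-- the three axisymmetric equilibrium equations imply
`2μ_m·(P_rr' + (P_rr − P_θθ)/r) + λ_m·(P_rr + P_θθ)' = 0` on the interval. -/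
theorem micro_equation_consequence (lo hi : ℝ) (hI : Set.Ioo lo hi ⊆ Set.Ioi (0 : ℝ))
    (lam_e μe lam_m μm μM Lc : ℝ) (u Prr Pθθ : ℝ → ℝ)
    (hu : ContDiffOn ℝ 2 u (Set.Ioo lo hi))
    (hPrr : ContDiffOn ℝ 2 Prr (Set.Ioo lo hi))
    (hPθθ : ContDiffOn ℝ 2 Pθθ (Set.Ioo lo hi))
    (heq1 : ∀ r ∈ Set.Ioo lo hi,
      (2 * μe + lam_e) * deriv (fun s => deriv u s - Prr s) r +
        lam_e * deriv (fun s => u s / s - Pθθ s) r =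
      -(2 * μe) * deriv (fun s => u s / s - Pθθ s) r -
        2 * μe * (deriv Pθθ r + (Pθθ r - Prr r) / r))
    (heq2 : ∀ r ∈ Set.Ioo lo hi,
      (2 * μe + lam_e) * (deriv u r - Prr r) + lam_e * (u r / r - Pθθ r) =
      2 * μm * Prr r + lam_m * (Prr r + Pθθ r) -
        μM * Lc ^ 2 / r * (deriv Pθθ r + (Pθθ r - Prr r) / r))
    (heq3 : ∀ r ∈ Set.Ioo lo hi,
      (2 * μe + lam_e) * (u r / r - Pθθ r) + lam_e * (deriv u r - Prr r) =
      2 * μm * Pθθ r + lam_m * (Prr r + Pθθ r) -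
        μM * Lc ^ 2 * deriv (fun s => deriv Pθθ s + (Pθθ s - Prr s) / s) r) :
    ∀ r ∈ Set.Ioo lo hi,
      2 * μm * (deriv Prr r + (Prr r - Pθθ r) / r) +
        lam_m * deriv (fun s => Prr s + Pθθ s) r = 0 := by
  intro r hr
  have hr0 : r ≠ 0 := (hI hr).ne'
  obtain ⟨du, ddu⟩ := hu.differentiableAt_and_deriv isOpen_Ioo hr
  obtain ⟨dP, -⟩ := hPrr.differentiableAt_and_deriv isOpen_Ioo hr
  obtain ⟨dQ, ddQ⟩ := hPθθ.differentiableAt_and_deriv isOpen_Ioo hr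
  have hA := ddu.hasDerivAt.sub dP.hasDerivAt
  have hB := (du.hasDerivAt.div (hasDerivAt_id r) hr0).sub dQ.hasDerivAt
  have hC := ddQ.hasDerivAt.add
    ((dQ.hasDerivAt.sub dP.hasDerivAt).div (hasDerivAt_id r) hr0)
  have hS := dP.hasDerivAt.add dQ.hasDerivAt
  have hk := (hasDerivAt_const r (μM * Lc ^ 2)).div (hasDerivAt_id r) hr0
  have hL := (hA.const_mul (2 * μe + lam_e)).add (hB.const_mul lam_e)
  have hR := ((dP.hasDerivAt.const_mul (2 * μm)).add (hS.const_mul lam_m)).sub (hk.mul hC)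
  have hderiv := hL.unique (hR.congr_of_eventuallyEq
    (eventually_of_mem (isOpen_Ioo.mem_nhds hr) heq2))
  have eA : deriv (fun s => deriv u s - Prr s) r = _ := hA.deriv
  have eB : deriv (fun s => u s / s - Pθθ s) r = _ := hB.deriv
  have eC : deriv (fun s => deriv Pθθ s + (Pθθ s - Prr s) / s) r = _ := hC.deriv
  have eS : deriv (fun s => Prr s + Pθθ s) r = _ := hS.deriv
  have h1 := heq1 r hr
  have h2 := heq2 r hr
  have h3 := heq3 r hr
  rw [eA, eB] at h1
  rw [eC] at h3
  rw [eS]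
  simp only [id, Pi.sub_apply, Pi.add_apply, Pi.div_apply] at h1 h2 h3 hderiv ⊢
  linear_combination (norm := (field_simp; ring)) h1 - hderiv + (h3 - h2) / r
end

section
/- The ratio of modified Bessel functions tends to one at infinity: lim_{x→∞} I₁(x)/I₀(x) = 1. -/
open Real Filter Set

/-- The `n`-th term of the series defining `I0`. -/
noncomputable def I0Term (x : ℝ) (n : ℕ) : ℝ :=
  x ^ (2 * n) / ((4 : ℝ) ^ n * ((n.factorial : ℝ)) ^ 2)

/-- The `n`-th term of the series defining `I1`. -/
noncomputable def I1Term (x : ℝ) (n : ℕ) : ℝ :=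
  x ^ (2 * n + 1) / ((2 : ℝ) ^ (2 * n + 1) * (n.factorial : ℝ) * (((n + 1).factorial : ℝ)))

lemma I0Term_nonneg (x : ℝ) (n : ℕ) : 0 ≤ I0Term x n := by
  unfold I0Term
  rw [pow_mul]
  positivity

lemma I1Term_eq (x : ℝ) (n : ℕ) : I1Term x n = x / 2 / (n + 1) * I0Term x n := by
  unfold I1Term I0Term
  rw [pow_succ, pow_succ, pow_mul 2, Nat.factorial_succ]
  push_cast
  norm_num
  field_simp

lemma succ_mul_I0Term_succ (x : ℝ) (n : ℕ) :
    ((n : ℝ) + 1) * I0Term x (n + 1) = x / 2 * I1Term x n := by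
  rw [I1Term_eq]
  unfold I0Term
  rw [Nat.factorial_succ]
  push_cast
  field_simp
  ring

lemma summable_I0Term (x : ℝ) : Summable (I0Term x) := by
  refine Summable.of_nonneg_of_le (I0Term_nonneg x) (fun n => ?_)
    (Real.summable_pow_div_factorial (x ^ 2 / 4))
  have hfac : (1 : ℝ) ≤ n.factorial := by exact_mod_cast n.factorial_pos
  unfold I0Term
  rw [div_pow, pow_mul, div_div]
  gcongr
  nlinarith

lemma summable_I1Term {x : ℝ} (hx : 0 < x) : Summable (I1Term x) := by
  refine Summable.of_nonneg_of_le (fun n => ?_) (fun n => ?_)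
    ((summable_I0Term x).mul_left (x / 2))
  · rw [I1Term_eq]
    have := I0Term_nonneg x n
    positivity
  · rw [I1Term_eq]
    refine mul_le_mul_of_nonneg_right (div_le_self (by positivity) ?_) (I0Term_nonneg x n)
    linarith [n.cast_nonneg (α := ℝ)]

lemma hasSum_I0Term (x : ℝ) : HasSum (I0Term x) (I0 x) := (summable_I0Term x).hasSum

lemma hasSum_I1Term {x : ℝ} (hx : 0 < x) : HasSum (I1Term x) (I1 x) :=
  (summable_I1Term hx).hasSum

lemma I0Term_zero (x : ℝ) : I0Term x 0 = 1 := by simp [I0Term]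

lemma I0_pos (x : ℝ) : 0 < I0 x := by
  have h := (hasSum_I0Term x).summable.le_tsum 0 (fun n _ => I0Term_nonneg x n)
  rw [(hasSum_I0Term x).tsum_eq, I0Term_zero] at h
  linarith

lemma hasSum_natCast_mul_I0Term {x : ℝ} (hx : 0 < x) :
    HasSum (fun n : ℕ => (n : ℝ) * I0Term x n) (x / 2 * I1 x) := by
  rw [← hasSum_nat_add_iff' 1]
  simpa [succ_mul_I0Term_succ] using (hasSum_I1Term hx).mul_left (x / 2)

lemma I1_le_I0 {x : ℝ} (hx : 0 < x) : I1 x ≤ I0 x := by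
  have hshift : HasSum (fun n => I0Term x (n + 1)) (I0 x - 1) := by
    simpa [I0Term_zero] using (hasSum_nat_add_iff' 1).2 (hasSum_I0Term x)
  have h := hasSum_le (fun n => ?_) ((hasSum_I1Term hx).mul_left 2)
    ((hasSum_I0Term x).add hshift)
  · linarith
  · have hn : (0 : ℝ) < n + 1 := by positivity
    have hsucc : I0Term x (n + 1) = (x / 2 / (n + 1)) ^ 2 * I0Term x n := by
      have := succ_mul_I0Term_succ x n
      rw [I1Term_eq] at this
      field_simp at this ⊢
      linarith
    rw [I1Term_eq, hsucc]
    nlinarith [mul_nonneg (sq_nonneg (x / 2 / (n + 1) - 1)) (I0Term_nonneg x n)]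

lemma one_sub_inv_mul_I0_le_I1 {x : ℝ} (hx : 0 < x) : (1 - x⁻¹) * I0 x ≤ I1 x := by
  have h := hasSum_le (fun n => ?_)
    (((hasSum_I0Term x).mul_left 2).sub
      (((hasSum_natCast_mul_I0Term hx).add (hasSum_I0Term x)).mul_left (2 / x)))
    (hasSum_I1Term hx)
  · field_simp at h ⊢
    linarith
  · have hn : (0 : ℝ) < n + 1 := by positivity
    have key : 2 - 2 / x * (n + 1) ≤ x / 2 / (n + 1) := by
      rw [← sub_nonneg]
      have : x / 2 / (n + 1) - (2 - 2 / x * (n + 1)) =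
          (x - 2 * (n + 1)) ^ 2 / (2 * x * (n + 1)) := by
        field_simp
        ring
      rw [this]
      positivity
    rw [I1Term_eq]
    linarith [mul_le_mul_of_nonneg_right key (I0Term_nonneg x n)]

/-- `I₁(x)/I₀(x) → 1` as `x → ∞`. -/
theorem I1_div_I0_tendsto_one :
    Filter.Tendsto (fun x : ℝ => I1 x / I0 x) Filter.atTop (nhds 1) := by
  have hlow : Tendsto (fun x : ℝ => 1 - x⁻¹) atTop (nhds 1) := by
    simpa using tendsto_inv_atTop_zero.const_sub (1 : ℝ)
  refine tendsto_of_tendsto_of_tendsto_of_le_of_le' hlow tendsto_const_nhds ?_ ?_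
  · filter_upwards [eventually_gt_atTop 0] with x hx
    exact (le_div_iff₀ (I0_pos x)).2 (one_sub_inv_mul_I0_le_I1 hx)
  · filter_upwards [eventually_gt_atTop 0] with x hx
    exact (div_le_one (I0_pos x)).2 (I1_le_I0 hx)
end

section
/- Let R > 0 and A, B, ξ₁, ξ₂, ξ₃ ∈ ℝ with B·ξ₃ − A·ξ₂ ≠ 0, and for a > 0 and r > 0 define F(a,r) = (A·r·(I₁(√a·R)·(2ξ₁ − ξ₂) − ξ₁·√a·R·I₀(√a·R)) + B·ξ₃·R·I₁(√a·r)) / (A·(I₁(√a·R)·(2ξ₁ − ξ₂) − ξ₁·√a·R·I₀(√a·R)) + B·ξ₃·I₁(√a·R)). Then for every fixed r > 0, lim_{a→0⁺} F(a,r) = r. (Hence the closed-form radial displacement u_r = (U₀/R)·F(a,r) of the relaxed micromorphic extension problem tends to the classical linear-elastic solution U₀·r/R as the characteristic length L_c → ∞, i.e. a → 0.) -/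
open Real Filter Set

theorem continuousAt_tsum_mul_pow_two_mul {c : ℕ → ℝ} (hc : ∀ n, |c n| ≤ 1 / (n.factorial : ℝ)) :
    ContinuousAt (fun x : ℝ => ∑' n, c n * x ^ (2 * n)) 0 := by
  have hs : Summable fun n : ℕ => 1 / (n.factorial : ℝ) := by
    simpa using Real.summable_pow_div_factorial 1
  have hcont : ContinuousOn (fun x : ℝ => ∑' n, c n * x ^ (2 * n)) (Set.Icc (-1) 1) := by
    refine continuousOn_tsum (fun n => by fun_prop) hs fun n x hx => ?_
    rw [Real.norm_eq_abs, abs_mul, abs_pow]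
    have hx' : |x| ^ (2 * n) ≤ 1 := pow_le_one₀ (abs_nonneg x) (abs_le.2 hx)
    exact (mul_le_of_le_one_right (abs_nonneg _) hx').trans (hc n)
  exact hcont.continuousAt (Icc_mem_nhds (by norm_num) (by norm_num))

theorem tsum_mul_zero_pow_two_mul (c : ℕ → ℝ) : ∑' n, c n * (0 : ℝ) ^ (2 * n) = c 0 := by
  rw [tsum_eq_single 0 fun n hn => by simp [hn]]
  simp

theorem tendsto_I0_zero : Filter.Tendsto I0 (nhds 0) (nhds 1) := by
  have hI : I0 = fun x => ∑' n : ℕ, 1 / ((4 : ℝ) ^ n * (n.factorial : ℝ) ^ 2) * x ^ (2 * n) := by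
    funext x
    exact tsum_congr fun n => by ring
  have hc := continuousAt_tsum_mul_pow_two_mul
    (c := fun n => 1 / ((4 : ℝ) ^ n * (n.factorial : ℝ) ^ 2)) fun n => by
      have h1 : (1 : ℝ) ≤ n.factorial := mod_cast n.factorial_pos
      have h4 : (1 : ℝ) ≤ 4 ^ n := one_le_pow₀ (by norm_num)
      rw [abs_of_nonneg (by positivity)]
      refine one_div_le_one_div_of_le (by positivity) ?_
      nlinarith [mul_le_mul h4 h1 zero_le_one (by positivity)]
  rw [← hI] at hc
  have h0 : I0 0 = 1 := by
    rw [hI]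
    exact (tsum_mul_zero_pow_two_mul _).trans (by simp)
  simpa [ContinuousAt, h0] using hc

theorem exists_I1_eq_mul_tendsto : ∃ J : ℝ → ℝ, (∀ x, I1 x = x * J x) ∧
    Filter.Tendsto J (nhds 0) (nhds (1 / 2)) := by
  let c : ℕ → ℝ := fun n =>
    1 / ((2 : ℝ) ^ (2 * n + 1) * (n.factorial : ℝ) * ((n + 1).factorial : ℝ))
  refine ⟨fun x => ∑' n, c n * x ^ (2 * n), fun x => ?_, ?_⟩
  · rw [← tsum_mul_left]
    exact tsum_congr fun n => by simp only [c]; ring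
  · have hc : ContinuousAt (fun x : ℝ => ∑' n, c n * x ^ (2 * n)) 0 :=
      continuousAt_tsum_mul_pow_two_mul fun n => by
        have h1 : (1 : ℝ) ≤ (n + 1).factorial := mod_cast (n + 1).factorial_pos
        have h2 : (1 : ℝ) ≤ 2 ^ (2 * n + 1) := one_le_pow₀ (by norm_num)
        simp only [c]
        rw [abs_of_nonneg (by positivity)]
        refine one_div_le_one_div_of_le (by positivity) ?_
        calc (n.factorial : ℝ) ≤ 2 ^ (2 * n + 1) * n.factorial :=
              le_mul_of_one_le_left (by positivity) h2
          _ ≤ _ := le_mul_of_one_le_right (by positivity) h1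
    have h0 : c 0 = 1 / 2 := by simp [c]
    simpa only [ContinuousAt, tsum_mul_zero_pow_two_mul, h0] using hc

/-- as `a → 0⁺` (i.e. `L_c → ∞`), the closed-form radial displacement
profile tends to the classical linear-elastic solution: `F(a,r) → r`. -/
theorem displacement_limit_Lc_infty (R A B ξ₁ ξ₂ ξ₃ : ℝ) (hR : 0 < R)
    (h : B * ξ₃ - A * ξ₂ ≠ 0) :
    let F : ℝ → ℝ → ℝ := fun a r =>
      (A * r * (I1 (Real.sqrt a * R) * (2 * ξ₁ - ξ₂) -
          ξ₁ * Real.sqrt a * R * I0 (Real.sqrt a * R)) +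
        B * ξ₃ * R * I1 (Real.sqrt a * r)) /
      (A * (I1 (Real.sqrt a * R) * (2 * ξ₁ - ξ₂) -
          ξ₁ * Real.sqrt a * R * I0 (Real.sqrt a * R)) +
        B * ξ₃ * I1 (Real.sqrt a * R))
    ∀ r : ℝ, 0 < r →
      Filter.Tendsto (fun a => F a r) (nhdsWithin 0 (Set.Ioi 0)) (nhds r) := by
  intro F r _
  obtain ⟨J, hJ, hJt⟩ := exists_I1_eq_mul_tendsto
  have hs (t : ℝ) : Filter.Tendsto (fun a => Real.sqrt a * t)
      (nhdsWithin 0 (Set.Ioi 0)) (nhds 0) := by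
    have hcont : Continuous fun a => Real.sqrt a * t := by fun_prop
    simpa using (hcont.tendsto 0).mono_left nhdsWithin_le_nhds
  have hJR := hJt.comp (hs R)
  have hJr := hJt.comp (hs r)
  have hD := ((hJR.mul_const (2 * ξ₁ - ξ₂)).sub
    ((tendsto_I0_zero.comp (hs R)).const_mul ξ₁)).const_mul A
  have hlim := ((hD.add (hJr.const_mul (B * ξ₃))).const_mul r).div
    (hD.add (hJR.const_mul (B * ξ₃))) (by
      intro h0
      apply h
      linarith)
  have hval : r * (A * (1 / 2 * (2 * ξ₁ - ξ₂) - ξ₁ * 1) + B * ξ₃ * (1 / 2)) /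
      (A * (1 / 2 * (2 * ξ₁ - ξ₂) - ξ₁ * 1) + B * ξ₃ * (1 / 2)) = r := by
    refine mul_div_cancel_right₀ r fun h0 => h ?_
    linarith
  rw [hval] at hlim
  refine hlim.congr' ?_
  filter_upwards [self_mem_nhdsWithin] with a ha
  have hsR : Real.sqrt a * R ≠ 0 := (mul_pos (Real.sqrt_pos.2 ha) hR).ne'
  simp only [F, hJ, Pi.div_apply, Function.comp_apply]
  rw [← mul_div_mul_left _ _ hsR]
  congr 1 <;> ring
end
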